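/- arXiv:2201.03635 — 2 statements merged into one kernel-verified Lean document; each statement's English description precedes it below -/
import Mathlib

section
/- Let u : ℝ × ℝ → ℝ be a smooth solution of equation (∗). Then the conservation law ∂_t[e^{−2x}(u + 2u_x + u_{xx})] + ∂_x[2e^{−2x}(u_t − 3u_x² − 3u u_x + u_{tx} − 3u u_{xx})] = 0 holds identically on ℝ × ℝ. -/
open Real MeasureTheory Set Filter

/-- Partial derivative of `u` with respect to the first (time) variable. -/
noncomputable def ut (u : ℝ × ℝ → ℝ) (t x : ℝ) : ℝ := deriv (fun s => u (s, x)) t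
/-- Partial derivative of `u` with respect to the second (spatial) variable. -/
noncomputable def ux (u : ℝ × ℝ → ℝ) (t x : ℝ) : ℝ := deriv (fun y => u (t, y)) x
noncomputable def uxx (u : ℝ × ℝ → ℝ) (t x : ℝ) : ℝ := deriv (fun y => ux u t y) x
noncomputable def uxxx (u : ℝ × ℝ → ℝ) (t x : ℝ) : ℝ := deriv (fun y => uxx u t y) x
noncomputable def utx (u : ℝ × ℝ → ℝ) (t x : ℝ) : ℝ := deriv (fun y => ut u t y) x
noncomputable def utxx (u : ℝ × ℝ → ℝ) (t x : ℝ) : ℝ := deriv (fun y => utx u t y) x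

/-- `u` satisfies the Novikov-type equation (∗) at the point `(t, x)`. -/
def SolvesAt (u : ℝ × ℝ → ℝ) (t x : ℝ) : Prop :=
  ut u t x - utxx u t x =
    4 * u (t, x) * ux u t x + 2 * (ux u t x) ^ 2 + 2 * u (t, x) * uxx u t x
      - 6 * ux u t x * uxx u t x - 2 * u (t, x) * uxxx u t x

/-- `u` is a solution of the Novikov-type equation (∗) on all of `ℝ × ℝ`. -/
def IsSolution (u : ℝ × ℝ → ℝ) : Prop := ∀ t x : ℝ, SolvesAt u t x

section PartialDerivatives

variable {u : ℝ × ℝ → ℝ}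

theorem ux_eq_fderiv (hu : Differentiable ℝ u) (t x : ℝ) :
    ux u t x = fderiv ℝ u (t, x) (0, 1) :=
  ((hu (t, x)).hasFDerivAt.comp_hasDerivAt x
    ((hasDerivAt_const x t).prodMk (hasDerivAt_id x))).deriv

theorem ut_eq_fderiv (hu : Differentiable ℝ u) (t x : ℝ) :
    ut u t x = fderiv ℝ u (t, x) (1, 0) :=
  ((hu (t, x)).hasFDerivAt.comp_hasDerivAt t
    ((hasDerivAt_id t).prodMk (hasDerivAt_const t x))).deriv

theorem contDiff_fderiv_apply_const (hu : ContDiff ℝ (⊤ : ℕ∞) u) (v : ℝ × ℝ) :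
    ContDiff ℝ (⊤ : ℕ∞) fun p => fderiv ℝ u p v :=
  (hu.fderiv_right (m := (⊤ : ℕ∞)) (by simp)).clm_apply contDiff_const

theorem contDiff_ux (hu : ContDiff ℝ (⊤ : ℕ∞) u) :
    ContDiff ℝ (⊤ : ℕ∞) fun p : ℝ × ℝ => ux u p.1 p.2 := by
  simpa only [ux_eq_fderiv (hu.differentiable (by simp))] using
    contDiff_fderiv_apply_const hu (0, 1)

theorem contDiff_ut (hu : ContDiff ℝ (⊤ : ℕ∞) u) :
    ContDiff ℝ (⊤ : ℕ∞) fun p : ℝ × ℝ => ut u p.1 p.2 := by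
  simpa only [ut_eq_fderiv (hu.differentiable (by simp))] using
    contDiff_fderiv_apply_const hu (1, 0)

theorem hasDerivAt_ux (hu : ContDiff ℝ (⊤ : ℕ∞) u) (t x : ℝ) :
    HasDerivAt (fun y => u (t, y)) (ux u t x) x :=
  ((hu.differentiable (by simp)).comp
    ((differentiable_const t).prodMk differentiable_id) x).hasDerivAt

theorem hasDerivAt_ut (hu : ContDiff ℝ (⊤ : ℕ∞) u) (t x : ℝ) :
    HasDerivAt (fun s => u (s, x)) (ut u t x) t :=
  ((hu.differentiable (by simp)).comp
    (differentiable_id.prodMk (differentiable_const x)) t).hasDerivAt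

/-- Equality of mixed partial derivatives. -/
theorem ut_ux_eq_utx (hu : ContDiff ℝ (⊤ : ℕ∞) u) (t x : ℝ) :
    ut (fun p => ux u p.1 p.2) t x = utx u t x := by
  have hd : Differentiable ℝ u := hu.differentiable (by simp)
  have hd2 : DifferentiableAt ℝ (fderiv ℝ u) (t, x) :=
    (hu.fderiv_right (m := (⊤ : ℕ∞)) (by simp)).differentiable (by simp) (t, x)
  have happly (v w : ℝ × ℝ) :
      fderiv ℝ (fun p => fderiv ℝ u p v) (t, x) w = fderiv ℝ (fderiv ℝ u) (t, x) w v := by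
    simp [fderiv_clm_apply hd2 (differentiableAt_const v)]
  have hsymm : IsSymmSndFDerivAt ℝ u (t, x) :=
    hu.contDiffAt.isSymmSndFDerivAt (by simpa using WithTop.coe_le_coe.2 (le_top : (2 : ℕ∞) ≤ ⊤))
  change _ = ux (fun p => ut u p.1 p.2) t x
  rw [ut_eq_fderiv ((contDiff_ux hu).differentiable (by simp)),
    ux_eq_fderiv ((contDiff_ut hu).differentiable (by simp))]
  simp only [ux_eq_fderiv hd, ut_eq_fderiv hd, Prod.mk.eta, happly]
  exact hsymm.eq _ _

end PartialDerivatives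

/-- The conserved current (3.0.2): on smooth solutions of (∗),
`∂_t [e^{−2x}(u + 2u_x + u_xx)] + ∂_x [2e^{−2x}(u_t − 3u_x² − 3u u_x + u_tx − 3u u_xx)] = 0`. -/
theorem conservation_law_two (u : ℝ × ℝ → ℝ) (hu : ContDiff ℝ (⊤ : ℕ∞) u)
    (hsol : IsSolution u) :
    ∀ t x : ℝ,
      deriv (fun s => Real.exp (-2 * x) * (u (s, x) + 2 * ux u s x + uxx u s x)) t +
        deriv (fun y => 2 * Real.exp (-2 * y) * (ut u t y - 3 * (ux u t y) ^ 2
          - 3 * u (t, y) * ux u t y + utx u t y - 3 * u (t, y) * uxx u t y)) x = 0 := by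
  intro t x
  have hux := contDiff_ux hu
  have hut := contDiff_ut hu
  have huxx := contDiff_ux hux
  have hutx := contDiff_ux hut
  have d_ux_t : HasDerivAt (fun s => ux u s x) (utx u t x) t := by
    simpa only [ut_ux_eq_utx hu] using hasDerivAt_ut hux t x
  have d_uxx_t : HasDerivAt (fun s => uxx u s x) (utxx u t x) t := by
    have h : utx (fun p => ux u p.1 p.2) t x = utxx u t x :=
      congrArg (fun f => deriv f x) (funext fun y => ut_ux_eq_utx hu t y)
    rw [← h, ← ut_ux_eq_utx hux]
    exact hasDerivAt_ut huxx t x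
  have d_u : HasDerivAt (fun y => u (t, y)) (ux u t x) x := hasDerivAt_ux hu t x
  have d_ux : HasDerivAt (fun y => ux u t y) (uxx u t x) x := hasDerivAt_ux hux t x
  have d_uxx : HasDerivAt (fun y => uxx u t y) (uxxx u t x) x := hasDerivAt_ux huxx t x
  have d_ut : HasDerivAt (fun y => ut u t y) (utx u t x) x := hasDerivAt_ux hut t x
  have d_utx : HasDerivAt (fun y => utx u t y) (utxx u t x) x := hasDerivAt_ux hutx t x
  have d_exp : HasDerivAt (fun y => Real.exp (-2 * y)) (Real.exp (-2 * x) * (-2)) x := by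
    simpa using ((hasDerivAt_id x).const_mul (-2)).exp
  have d_density := (((hasDerivAt_ut hu t x).fun_add (d_ux_t.const_mul 2)).fun_add
    d_uxx_t).const_mul (Real.exp (-2 * x))
  have d_flux := (d_exp.const_mul 2).fun_mul
    ((((d_ut.fun_sub ((d_ux.fun_pow 2).const_mul 3)).fun_sub
      ((d_u.const_mul 3).fun_mul d_ux)).fun_add d_utx).fun_sub
      ((d_u.const_mul 3).fun_mul d_uxx))
  rw [d_density.deriv, d_flux.deriv]
  have heq : ut u t x - utxx u t x = _ := hsol t x
  push_cast
  linear_combination (-3 * Real.exp (-2 * x)) * heq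
end

section
/- Let a < b be real numbers and let v, w : ℝ → ℝ be differentiable functions with v² Lebesgue integrable on ℝ, satisfying the pointwise relation w(x) + v(x)² − 2v(x)v'(x) = ∫_ℝ G(x − y) v(y)² dy for all x ∈ ℝ, where G(x) = (1 − sgn(x))·e^{−|x|}/2. If w(a) = w(b) = 0 and v(x) = 0 for all x ∈ [a,b], then v(x) = 0 for all x ≥ a. -/
open Real MeasureTheory Set Filter

/-- The kernel `G (x) = (1 − sgn x) e^{−|x|} / 2` (with `sgn 0 = 0`). -/
noncomputable def G (x : ℝ) : ℝ := (1 - Real.sign x) * Real.exp (-|x|) / 2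

theorem G_eq_exp_of_neg {x : ℝ} (hx : x < 0) : G x = Real.exp x := by
  rw [G, Real.sign_of_neg hx, abs_of_neg hx, neg_neg]
  ring

theorem G_nonneg (x : ℝ) : 0 ≤ G x := by
  have := Real.exp_pos (-|x|)
  rcases Real.sign_apply_eq x with h | h | h <;> rw [G, h] <;> linarith

theorem G_le_one (x : ℝ) : G x ≤ 1 := by
  have h0 := Real.exp_pos (-|x|)
  have h1 : Real.exp (-|x|) ≤ 1 := Real.exp_le_one_iff.2 (neg_nonpos.2 (abs_nonneg x))
  rcases Real.sign_apply_eq x with h | h | h <;> rw [G, h] <;> linarith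

theorem measurable_G : Measurable G := by
  have hsign : Measurable Real.sign := by
    refine Measurable.ite measurableSet_Iio measurable_const ?_
    exact Measurable.ite measurableSet_Ioi measurable_const measurable_const
  unfold G
  fun_prop

/-- If the convolution of `G` with a nonnegative continuous integrable function vanishes at `a`,
then the function vanishes to the right of `a`. -/
theorem eq_zero_of_integral_G_mul_eq_zero {f : ℝ → ℝ} (hf : Continuous f) (hf0 : ∀ y, 0 ≤ f y)
    (hint : Integrable f) {a : ℝ} (h : ∫ y, G (a - y) * f y = 0) {x : ℝ} (hx : a < x) :
    f x = 0 := by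
  have hG : Integrable fun y => G (a - y) * f y := by
    refine hint.bdd_mul (c := 1)
      (measurable_G.comp (measurable_const.sub measurable_id)).aestronglyMeasurable
      (ae_of_all _ fun y => ?_)
    simpa [abs_of_nonneg (G_nonneg _)] using G_le_one (a - y)
  have hae := (integral_eq_zero_iff_of_nonneg
    (fun y => mul_nonneg (G_nonneg (a - y)) (hf0 y)) hG).1 h
  by_contra hne
  have hopen : IsOpen (Ioi a ∩ {y | f y ≠ 0}) :=
    isOpen_Ioi.inter (isOpen_ne_fun hf continuous_const)
  refine (hopen.measure_pos volume ⟨x, hx, hne⟩).ne' (measure_mono_null ?_ hae)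
  rintro y ⟨hy, hfy⟩
  rw [mem_Ioi, ← sub_neg] at hy
  simp [G_eq_exp_of_neg hy, (Real.exp_pos _).ne', show f y ≠ 0 from hfy]

/-- Theorem 4.3 (at a fixed time): if `w + v² − 2 v v' = G ∗ v²` pointwise, `w` vanishes at
`a` and `b`, and `v` vanishes on `[a, b]`, then `v` vanishes on `[a, ∞)`. -/
theorem unique_continuation_fixed_time (a b : ℝ) (hab : a < b) (v w : ℝ → ℝ)
    (hv : Differentiable ℝ v) (hw : Differentiable ℝ w)
    (hint : Integrable (fun y => (v y) ^ 2))
    (heq : ∀ x : ℝ,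
      w x + (v x) ^ 2 - 2 * v x * deriv v x = ∫ y : ℝ, G (x - y) * (v y) ^ 2)
    (hwa : w a = 0) (hwb : w b = 0)
    (hvab : ∀ x ∈ Set.Icc a b, v x = 0) :
    ∀ x : ℝ, a ≤ x → v x = 0 := by
  intro x hx
  have hva : v a = 0 := hvab a (left_mem_Icc.2 hab.le)
  rcases hx.eq_or_lt with rfl | hx
  · exact hva
  have hzero : ∫ y : ℝ, G (a - y) * (v y) ^ 2 = 0 := by
    rw [← heq a, hwa, hva]
    ring
  exact pow_eq_zero_iff two_ne_zero |>.1 <| eq_zero_of_integral_G_mul_eq_zero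
    (hv.continuous.pow 2) (fun y => sq_nonneg (v y)) hint hzero hx
end
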